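/- arXiv:2502.11467 — 3 statements merged into one kernel-verified Lean document; each statement's English description precedes it below -/
import Mathlib

section
/- For every d, n, s, N, L ∈ ℕ₊ there exists a Transformer network T of width d' at most 12·(2d)^s·N and depth at most (s−1)(2L+3)+1, each of whose attention layers has a single head, such that for every X ∈ [0,1]^{d×n}, feeding T the matrix in ℝ^{d'×(n+1)} whose top-left d×n block is X and whose remaining entries are 0, the following holds: for every r with 1 ≤ r ≤ s and all p_1,…,p_r ∈ ℕ^d with |p_j| ≥ 1 for each j and |p_1|+⋯+|p_r| ≤ s, a designated coordinate of the (n+1)-th output column equals m_{p_1,…,p_r}(X) + E_{p_1,…,p_r}(X) with |E_{p_1,…,p_r}(X)| ≤ (P(n+r−1,r)·(|p_1|+1)⋯(|p_r|+1) − n^r)·N^{−L}, where P(a,b) := a!/(a−b)!. -/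
open scoped Matrix

/-- Entrywise ReLU. -/
def relu (x : ℝ) : ℝ := max 0 x

/-- Entrywise ReLU on matrices. -/
def reluM {a b : ℕ} (X : Matrix (Fin a) (Fin b) ℝ) : Matrix (Fin a) (Fin b) ℝ :=
  Matrix.of fun i j => relu (X i j)

/-- Column-wise softmax: entry `(i,j)` is `exp(−A_{ij}) / Σ_l exp(−A_{lj})`. -/
noncomputable def softmax {n : ℕ} (A : Matrix (Fin n) (Fin n) ℝ) :
    Matrix (Fin n) (Fin n) ℝ :=
  Matrix.of fun i j => Real.exp (-(A i j)) / ∑ l, Real.exp (-(A l j))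

/-- The parameters of an attention layer on `ℝ^{d×·}` with `h` heads and inner
dimension `m`. -/
structure AttnLayer (d : ℕ) where
  m : ℕ
  h : ℕ
  WO : Fin h → Matrix (Fin d) (Fin m) ℝ
  WV : Fin h → Matrix (Fin m) (Fin d) ℝ
  WK : Fin h → Matrix (Fin m) (Fin d) ℝ
  WQ : Fin h → Matrix (Fin m) (Fin d) ℝ

/-- `Attn(X) = X + Σ_i WO^i WV^i X · softmax((WK^i X)^⊤ WQ^i X)`. -/
noncomputable def AttnLayer.apply {d : ℕ} (A : AttnLayer d) {n : ℕ}
    (X : Matrix (Fin d) (Fin n) ℝ) : Matrix (Fin d) (Fin n) ℝ :=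
  X + ∑ i, A.WO i * (A.WV i * X * softmax ((A.WK i * X)ᵀ * (A.WQ i * X)))

/-- The parameters of a feed-forward layer on `ℝ^{d×·}` with inner dimension `r`. -/
structure FFLayer (d : ℕ) where
  r : ℕ
  W1 : Matrix (Fin r) (Fin d) ℝ
  W2 : Matrix (Fin d) (Fin r) ℝ
  b1 : Fin r → ℝ
  b2 : Fin d → ℝ

/-- `FF(X) = X + W₂ · ReLU(W₁ X + b₁ 1ₙ^⊤) + b₂ 1ₙ^⊤`. -/
def FFLayer.apply {d : ℕ} (F : FFLayer d) {n : ℕ}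
    (X : Matrix (Fin d) (Fin n) ℝ) : Matrix (Fin d) (Fin n) ℝ :=
  X + F.W2 * reluM (F.W1 * X + Matrix.of fun i _ => F.b1 i) +
    Matrix.of fun i _ => F.b2 i

/-- A Transformer block `TB = FF ∘ Attn`. -/
structure TransformerBlock (d : ℕ) where
  attn : AttnLayer d
  ff : FFLayer d

/-- Applying a Transformer block: `TB(X) = FF(Attn(X))`. -/
noncomputable def TransformerBlock.apply {d : ℕ} (B : TransformerBlock d) {n : ℕ}
    (X : Matrix (Fin d) (Fin n) ℝ) : Matrix (Fin d) (Fin n) ℝ :=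
  B.ff.apply (B.attn.apply X)

/-- Applying a Transformer network (a composition of Transformer blocks). -/
noncomputable def applyNet {d : ℕ} (net : List (TransformerBlock d)) {n : ℕ}
    (X : Matrix (Fin d) (Fin n) ℝ) : Matrix (Fin d) (Fin n) ℝ :=
  net.foldl (fun Y B => B.apply Y) X

/-- Embed a `d × n` matrix into the top-left block of a `d' × n'` matrix,
filling the remaining entries with zeros. -/
def embed {d n : ℕ} (d' n' : ℕ) (X : Matrix (Fin d) (Fin n) ℝ) :
    Matrix (Fin d') (Fin n') ℝ :=
  Matrix.of fun i j =>
    if h : (i : ℕ) < d ∧ (j : ℕ) < n then X ⟨i, h.1⟩ ⟨j, h.2⟩ else 0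

/-- The rank-`r` monomial column-symmetric polynomial
`m_{p_1,…,p_r}(X) = Σ_{σ ∈ S_n} (1/(n−r)!) x_{σ(1)}^{p_1} ⋯ x_{σ(r)}^{p_r}`
(as a function), with the convention that it is `0` if `r > n`. -/
noncomputable def msym {d n r : ℕ} (p : Fin r → Fin d → ℕ)
    (X : Matrix (Fin d) (Fin n) ℝ) : ℝ :=
  if h : r ≤ n then
    (((n - r).factorial : ℕ) : ℝ)⁻¹ *
      ∑ σ : Equiv.Perm (Fin n), ∏ j : Fin r, ∏ i : Fin d,
        X i (σ (Fin.castLE h j)) ^ p j i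
  else 0

/-! ### Approximate multiplication by ReLU layers -/

/-- Slope changes, at the knots `k / N`, of the zigzag function with `N` teeth minus the identity. -/
noncomputable def zigzagCoef (N k : ℕ) : ℝ :=
  if k = 0 then (N : ℝ) - 1 else (-1) ^ k * (2 * N)

/-- Slope changes, at the knots `k / N`, of the interpolation of `z ↦ z * (1 - z)`. -/
noncomputable def hatCoef (N k : ℕ) : ℝ :=
  if k = 0 then 1 - 1 / (N : ℝ) else -(2 / N)

/-- The zigzag function, mapping each `[k / N, (k + 1) / N]` linearly onto `[0, 1]`. -/
noncomputable def zigzag (N : ℕ) (z : ℝ) : ℝ :=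
  z + ∑ k : Fin N, zigzagCoef N k * relu (z - k / N)

/-- The piecewise linear interpolation of `z ↦ z * (1 - z)` at the knots `k / N`. -/
noncomputable def hat (N : ℕ) (z : ℝ) : ℝ :=
  ∑ k : Fin N, hatCoef N k * relu (z - k / N)

lemma relu_of_nonneg {x : ℝ} (h : 0 ≤ x) : relu x = x := max_eq_right h

lemma relu_of_nonpos {x : ℝ} (h : x ≤ 0) : relu x = 0 := max_eq_left h

/-- On the `m`-th linear piece only the first `m + 1` knots are active. -/
lemma sum_coef_relu {N m : ℕ} (hm : m < N) {z : ℝ} (h1 : (m : ℝ) / N ≤ z)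
    (h2 : z ≤ (m + 1 : ℝ) / N) (c : ℕ → ℝ) :
    ∑ k : Fin N, c k * relu (z - k / N) = ∑ k ∈ Finset.range (m + 1), c k * (z - k / N) := by
  have hN : (0 : ℝ) < N := by exact_mod_cast (by omega : 0 < N)
  rw [Fin.sum_univ_eq_sum_range (fun k => c k * relu (z - k / N)) N,
    ← Finset.sum_subset (Finset.range_mono (Nat.succ_le_of_lt hm))]
  · refine Finset.sum_congr rfl fun k hk => ?_
    have hk' : (k : ℝ) ≤ m := by exact_mod_cast Nat.lt_succ_iff.mp (Finset.mem_range.mp hk)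
    rw [relu_of_nonneg]
    have : (k : ℝ) / N ≤ m / N := by gcongr
    linarith
  · intro k _ hk
    have hk' : (m : ℝ) + 1 ≤ k := by
      exact_mod_cast Nat.le_of_not_lt (fun h => hk (Finset.mem_range.mpr h))
    have : (m + 1 : ℝ) / N ≤ k / N := by gcongr
    rw [relu_of_nonpos (by linarith), mul_zero]

lemma zigzag_eq {N m : ℕ} (hm : m < N) {z : ℝ} (h1 : (m : ℝ) / N ≤ z)
    (h2 : z ≤ (m + 1 : ℝ) / N) :
    zigzag N z = if Even m then N * z - m else 1 - (N * z - m) := by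
  have hN : (N : ℝ) ≠ 0 := by exact_mod_cast (by omega : N ≠ 0)
  rw [zigzag, sum_coef_relu hm h1 h2 (zigzagCoef N)]
  clear h1 h2 hm
  induction m with
  | zero => simp [zigzagCoef]; ring
  | succ m ih =>
    rw [Finset.sum_range_succ, ← add_assoc, ih]
    rcases Nat.even_or_odd m with hm | hm
    · have hm' : ¬ Even (m + 1) := by simpa [Nat.even_add_one] using hm
      simp only [hm, hm', if_true, if_false, zigzagCoef, Nat.succ_ne_zero, pow_succ, hm.neg_one_pow]
      push_cast
      field_simp
      ring
    · have hm' : Even (m + 1) := hm.add_one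
      simp only [Nat.not_even_iff_odd.mpr hm, hm', if_true, if_false, zigzagCoef,
        Nat.succ_ne_zero, pow_succ, hm.neg_one_pow]
      push_cast
      field_simp
      ring

lemma hat_eq {N m : ℕ} (hm : m < N) {z : ℝ} (h1 : (m : ℝ) / N ≤ z)
    (h2 : z ≤ (m + 1 : ℝ) / N) :
    hat N z = z * (1 - z) - (1 / (N : ℝ) ^ 2) * ((N * z - m) * (1 - (N * z - m))) := by
  have hN : (N : ℝ) ≠ 0 := by exact_mod_cast (by omega : N ≠ 0)
  rw [hat, sum_coef_relu hm h1 h2 (hatCoef N)]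
  clear h1 h2 hm
  induction m with
  | zero => simp [hatCoef]; field_simp; ring
  | succ m ih =>
    rw [Finset.sum_range_succ, ih]
    simp only [hatCoef, Nat.succ_ne_zero, if_false]
    push_cast
    field_simp
    ring

lemma exists_piece {N : ℕ} (hN : 0 < N) {z : ℝ} (hz : z ∈ Set.Icc (0 : ℝ) 1) :
    ∃ m < N, (m : ℝ) / N ≤ z ∧ z ≤ (m + 1 : ℝ) / N := by
  have hN' : (0 : ℝ) < N := by exact_mod_cast hN
  rcases hz.2.lt_or_eq with h | rfl
  · have h0 : 0 ≤ z * N := mul_nonneg hz.1 hN'.le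
    refine ⟨⌊z * N⌋₊, (Nat.floor_lt h0).mpr (by nlinarith), ?_, ?_⟩
    · rw [div_le_iff₀ hN']; exact Nat.floor_le h0
    · rw [le_div_iff₀ hN']; exact (Nat.lt_floor_add_one _).le
  · refine ⟨N - 1, by omega, ?_, ?_⟩ <;> rw [Nat.cast_sub (by omega)]
    · rw [div_le_one hN']; push_cast; linarith
    · rw [one_le_div hN']; push_cast; linarith

lemma zigzag_mem {N : ℕ} (hN : 0 < N) {z : ℝ} (hz : z ∈ Set.Icc (0 : ℝ) 1) :
    zigzag N z ∈ Set.Icc (0 : ℝ) 1 := by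
  obtain ⟨m, hm, h1, h2⟩ := exists_piece hN hz
  have hN' : (0 : ℝ) < N := by exact_mod_cast hN
  rw [zigzag_eq hm h1 h2]
  rw [div_le_iff₀ hN'] at h1
  rw [le_div_iff₀ hN'] at h2
  split_ifs <;> constructor <;> linarith

lemma hat_zigzag {N : ℕ} (hN : 0 < N) {z : ℝ} (hz : z ∈ Set.Icc (0 : ℝ) 1) :
    z * (1 - z) = hat N z + (1 / (N : ℝ) ^ 2) * (zigzag N z * (1 - zigzag N z)) := by
  obtain ⟨m, hm, h1, h2⟩ := exists_piece hN hz
  rw [zigzag_eq hm h1 h2, hat_eq hm h1 h2]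
  split_ifs <;> ring

lemma zigzag_iterate_mem {N : ℕ} (hN : 0 < N) {z : ℝ} (hz : z ∈ Set.Icc (0 : ℝ) 1) (k : ℕ) :
    (zigzag N)^[k] z ∈ Set.Icc (0 : ℝ) 1 := by
  induction k with
  | zero => exact hz
  | succ k ih => rw [Function.iterate_succ_apply']; exact zigzag_mem hN ih

lemma sum_hat_iterate {N : ℕ} (hN : 0 < N) {z : ℝ} (hz : z ∈ Set.Icc (0 : ℝ) 1) (K : ℕ) :
    z * (1 - z) = ∑ k ∈ Finset.range K, (1 / (N : ℝ) ^ 2) ^ k * hat N ((zigzag N)^[k] z) +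
      (1 / (N : ℝ) ^ 2) ^ K * ((zigzag N)^[K] z * (1 - (zigzag N)^[K] z)) := by
  induction K with
  | zero => simp
  | succ K ih =>
    rw [ih, hat_zigzag hN (zigzag_iterate_mem hN hz K), Finset.sum_range_succ,
      Function.iterate_succ_apply']
    ring

/-- The running value, after `K` layers, of the approximation of `x * y`. -/
noncomputable def mulAcc (N : ℕ) (x y : ℝ) (K : ℕ) : ℝ :=
  relu ((x + y) / 2) + ∑ k ∈ Finset.range K, (1 / (N : ℝ) ^ 2) ^ k *
    (hat N ((zigzag N)^[k] (relu x)) / 2 + hat N ((zigzag N)^[k] (relu y)) / 2 -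
      2 * hat N ((zigzag N)^[k] (relu ((x + y) / 2))))

/-- The approximation of `x * y`, clipped to `[0, x]`. -/
noncomputable def mulApprox (N L : ℕ) (x y : ℝ) : ℝ :=
  relu (mulAcc N x y L) - relu (mulAcc N x y L - x)

lemma abs_mulAcc_sub_le {N : ℕ} (hN : 0 < N) {x y : ℝ} (hx : x ∈ Set.Icc (0 : ℝ) 1)
    (hy : y ∈ Set.Icc (0 : ℝ) 1) (K : ℕ) :
    |mulAcc N x y K - x * y| ≤ (1 / (N : ℝ) ^ 2) ^ K := by
  have hm : (x + y) / 2 ∈ Set.Icc (0 : ℝ) 1 :=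
    ⟨by linarith [hx.1, hy.1], by linarith [hx.2, hy.2]⟩
  have key : ∀ z ∈ Set.Icc (0 : ℝ) 1,
      0 ≤ (zigzag N)^[K] z * (1 - (zigzag N)^[K] z) ∧
        (zigzag N)^[K] z * (1 - (zigzag N)^[K] z) ≤ 1 / 4 := by
    intro z hz
    obtain ⟨h0, h1⟩ := zigzag_iterate_mem hN hz K
    exact ⟨mul_nonneg h0 (by linarith), by nlinarith [sq_nonneg ((zigzag N)^[K] z - 1 / 2)]⟩
  have ex := sum_hat_iterate hN hx K
  have ey := sum_hat_iterate hN hy K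
  have em := sum_hat_iterate hN hm K
  obtain ⟨kx, kx'⟩ := key x hx
  obtain ⟨ky, ky'⟩ := key y hy
  obtain ⟨km, km'⟩ := key _ hm
  have hε : 0 ≤ (1 / (N : ℝ) ^ 2) ^ K := by positivity
  rw [mulAcc, relu_of_nonneg hx.1, relu_of_nonneg hy.1, relu_of_nonneg hm.1]
  simp only [mul_sub, mul_add, Finset.sum_sub_distrib, Finset.sum_add_distrib, ← mul_div_assoc,
    ← Finset.sum_div, mul_left_comm _ (2 : ℝ), ← Finset.mul_sum]
  simp only [mul_sub, mul_one] at ex ey em kx kx' ky ky' km km'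
  generalize (1 / (N : ℝ) ^ 2) ^ K = ε at *
  rw [abs_le]
  constructor <;> nlinarith [mul_le_mul_of_nonneg_left kx' hε, mul_le_mul_of_nonneg_left ky' hε,
    mul_le_mul_of_nonneg_left km' hε, mul_nonneg hε kx, mul_nonneg hε ky, mul_nonneg hε km]

lemma mulApprox_zero_left (N L : ℕ) (y : ℝ) : mulApprox N L 0 y = 0 := by
  simp [mulApprox]

lemma mulApprox_spec {N : ℕ} (hN : 0 < N) (L : ℕ) {x y : ℝ} (hx : x ∈ Set.Icc (0 : ℝ) 1)
    (hy : y ∈ Set.Icc (0 : ℝ) 1) :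
    mulApprox N L x y ∈ Set.Icc (0 : ℝ) 1 ∧ |mulApprox N L x y - x * y| ≤ 1 / (N : ℝ) ^ L := by
  have hN' : (1 : ℝ) ≤ N := by exact_mod_cast hN
  have h : (1 / (N : ℝ) ^ 2) ^ L ≤ 1 / (N : ℝ) ^ L := by
    rw [one_div_pow, ← pow_mul]
    exact one_div_le_one_div_of_le (by positivity) (pow_le_pow_right₀ hN' (by omega))
  have hacc := abs_le.mp ((abs_mulAcc_sub_le hN hx hy L).trans h)
  have hxy : x * y ≤ x := mul_le_of_le_one_right hx.1 hy.2
  have hxy0 : 0 ≤ x * y := mul_nonneg hx.1 hy.1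
  obtain ⟨hx0, hx1⟩ := hx
  rw [mulApprox, Set.mem_Icc, abs_le]
  generalize mulAcc N x y L = a at *
  rcases le_total a 0 with h0 | h0
  · rw [relu_of_nonpos h0, relu_of_nonpos (by linarith)]
    refine ⟨⟨?_, ?_⟩, ?_, ?_⟩ <;> linarith
  · rw [relu_of_nonneg h0]
    rcases le_total a x with h1 | h1
    · rw [relu_of_nonpos (by linarith)]
      refine ⟨⟨?_, ?_⟩, ?_, ?_⟩ <;> linarith
    · rw [relu_of_nonneg (by linarith)]
      refine ⟨⟨?_, ?_⟩, ?_, ?_⟩ <;> linarith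

/-! ### Monomial column-symmetric polynomials as combinations of products of power sums -/

lemma card_perm_extending {n r : ℕ} (h : r ≤ n) (f : Fin r ↪ Fin n) :
    Fintype.card {σ : Equiv.Perm (Fin n) // (Fin.castLEEmb h).trans σ.toEmbedding = f} =
      (n - r).factorial := by
  classical
  have hconst : ∀ f : Fin r ↪ Fin n,
      Fintype.card {σ : Equiv.Perm (Fin n) // (Fin.castLEEmb h).trans σ.toEmbedding = f} =
        Fintype.card {σ : Equiv.Perm (Fin n) // (Fin.castLEEmb h).trans σ.toEmbedding =
          Fin.castLEEmb h} := by
    intro f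
    obtain ⟨τ, hτ⟩ := Equiv.Perm.exists_extending_pair (Fin.castLEEmb h) f
      (Fin.castLEEmb h).injective f.injective
    refine Fintype.card_congr ((Equiv.mulLeft τ⁻¹).subtypeEquiv fun σ => ?_)
    simp only [DFunLike.ext_iff, Function.Embedding.trans_apply, Equiv.coe_toEmbedding,
      Equiv.coe_mulLeft, Equiv.Perm.mul_apply, Equiv.Perm.inv_eq_iff_eq]
    exact forall_congr' fun j => by rw [show τ (Fin.castLEEmb h j) = f j from hτ j]
  have hsum : Fintype.card (Equiv.Perm (Fin n)) = ∑ g : Fin r ↪ Fin n,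
      Fintype.card {σ : Equiv.Perm (Fin n) // (Fin.castLEEmb h).trans σ.toEmbedding = g} := by
    rw [← Fintype.card_sigma]
    exact Fintype.card_congr (Equiv.sigmaFiberEquiv _).symm
  rw [Finset.sum_congr rfl fun g _ => hconst g] at hsum
  simp only [Finset.sum_const, Finset.card_univ, Fintype.card_embedding_eq, Fintype.card_perm,
    Fintype.card_fin, smul_eq_mul] at hsum
  rw [hconst f]
  refine Nat.eq_of_mul_eq_mul_left (Nat.descFactorial_pos.mpr h) ?_
  rw [← hsum, mul_comm, Nat.factorial_mul_descFactorial h]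

lemma msym_eq_sum_embedding {d n r : ℕ} (p : Fin r → Fin d → ℕ) (X : Matrix (Fin d) (Fin n) ℝ) :
    msym p X = ∑ f : Fin r ↪ Fin n, ∏ j, ∏ i, X i (f j) ^ p j i := by
  classical
  rw [msym]
  split_ifs with h
  · rw [← Equiv.sum_comp (Equiv.sigmaFiberEquiv
      fun σ : Equiv.Perm (Fin n) => (Fin.castLEEmb h).trans σ.toEmbedding), Fintype.sum_sigma,
      Finset.mul_sum]
    refine Finset.sum_congr rfl fun f _ => ?_
    rw [Finset.sum_congr rfl (g := fun _ => ∏ j, ∏ i, X i (f j) ^ p j i)]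
    · rw [Finset.sum_const, Finset.card_univ, card_perm_extending h f, nsmul_eq_mul,
        inv_mul_cancel_left₀ (by exact_mod_cast Nat.factorial_ne_zero _)]
    · rintro ⟨σ, hσ⟩ _
      refine Finset.prod_congr rfl fun j _ => ?_
      subst hσ
      rfl
  · have : IsEmpty (Fin r ↪ Fin n) :=
      ⟨fun f => h (by simpa using Fintype.card_le_of_embedding f)⟩
    simp

/-- The power sum `∑ⱼ xⱼ ^ q`. -/
noncomputable def powerSum {d n : ℕ} (q : Fin d → ℕ) (X : Matrix (Fin d) (Fin n) ℝ) : ℝ :=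
  ∑ j, ∏ i, X i j ^ q i

lemma msym_succ {d n r : ℕ} (p : Fin (r + 1) → Fin d → ℕ) (X : Matrix (Fin d) (Fin n) ℝ) :
    msym p X = powerSum (p 0) X * msym (Fin.tail p) X -
      ∑ k, msym (Function.update (Fin.tail p) k (p 0 + Fin.tail p k)) X := by
  classical
  simp only [msym_eq_sum_embedding]
  rw [← Equiv.sum_comp (Equiv.embeddingFinSucc r (Fin n)).symm, Fintype.sum_sigma,
    Finset.sum_comm, Finset.mul_sum, ← Finset.sum_sub_distrib]
  refine Finset.sum_congr rfl fun g _ => ?_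
  simp only [Equiv.coe_embeddingFinSucc_symm, Fin.prod_univ_succ, Fin.cons_zero, Fin.cons_succ]
  rw [← Finset.sum_mul, eq_sub_iff_add_eq]
  have hupd : ∀ k, ∏ j, ∏ i, X i (g j) ^ Function.update (Fin.tail p) k (p 0 + Fin.tail p k) j i =
      (∏ i, X i (g k) ^ p 0 i) * ∏ j, ∏ i, X i (g j) ^ p j.succ i := by
    intro k
    rw [← Finset.mul_prod_erase _ _ (Finset.mem_univ k),
      ← Finset.mul_prod_erase _ (fun j => ∏ i, X i (g j) ^ p j.succ i) (Finset.mem_univ k),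
      ← mul_assoc]
    congr 1
    · simp [pow_add, Finset.prod_mul_distrib, Fin.tail]
    · refine Finset.prod_congr rfl fun j hj => ?_
      rw [Function.update_of_ne (Finset.ne_of_mem_erase hj)]
      rfl
  simp only [hupd]
  rw [← Finset.sum_mul, ← add_mul]
  congr 1
  rw [powerSum, ← Fintype.sum_subtype_add_sum_subtype (fun a => a ∉ Set.range g), add_right_inj]
  exact Fintype.sum_equiv ((Equiv.ofInjective g g.injective).trans
    (Equiv.subtypeEquivRight fun a => not_not.symm)) _ _ fun _ => rfl

/-! ### Words encoding products of power sums -/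

/-- A letter `(i, b)` multiplies by the `i`-th coordinate, after averaging over columns if `b`. -/
abbrev Letter (d : ℕ) := Fin d × Bool

/-- An initial coordinate followed by fewer than `s` letters, the last one coming first. -/
abbrev Word (d s : ℕ) := Fin d × {l : List (Letter d) // l.length < s}

/-- The value in each column of a word, with multiplication `μ` and averages normalized by `n`. -/
noncomputable def wordVal {d m : ℕ} (μ : ℝ → ℝ → ℝ) (n : ℕ) (Z : Fin d → Fin m → ℝ) (i₀ : Fin d) :
    List (Letter d) → Fin m → ℝ
  | [], j => Z i₀ j
  | a :: l, j => μ (Z a.1 j) (if a.2 then (∑ k, wordVal μ n Z i₀ l k) / n else wordVal μ n Z i₀ l j)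

/-- The exponent of the monomial in progress at the end of a word. -/
def wordHead {d : ℕ} (i₀ : Fin d) : List (Letter d) → Fin d → ℕ
  | [] => Pi.single i₀ 1
  | a :: l => Pi.single a.1 1 + if a.2 then 0 else wordHead i₀ l

/-- The exponents of the power sums completed within a word. -/
def wordRest {d : ℕ} (i₀ : Fin d) : List (Letter d) → List (Fin d → ℕ)
  | [] => []
  | a :: l => if a.2 then wordHead i₀ l :: wordRest i₀ l else wordRest i₀ l

/-- The normalized product of power sums encoded by a word. -/
noncomputable def wordProd {d n : ℕ} (i₀ : Fin d) (l : List (Letter d))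
    (X : Matrix (Fin d) (Fin n) ℝ) : ℝ :=
  ((wordHead i₀ l :: wordRest i₀ l).map fun q => powerSum q X / n).prod

lemma prod_pow_single_add {d : ℕ} (x : Fin d → ℝ) (i : Fin d) (q : Fin d → ℕ) :
    ∏ k, x k ^ (Pi.single i 1 + q : Fin d → ℕ) k = x i * ∏ k, x k ^ q k := by
  simp only [Pi.add_apply, pow_add, Finset.prod_mul_distrib]
  congr 1
  simp [Pi.single_apply, pow_ite]

lemma wordVal_mul {d n : ℕ} (i₀ : Fin d) (l : List (Letter d)) (X : Matrix (Fin d) (Fin n) ℝ)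
    (Z : Fin d → Fin (n + 1) → ℝ) (hZ : ∀ i k, Z i (Fin.castSucc k) = X i k)
    (hZl : ∀ i, Z i (Fin.last n) = 0) :
    wordVal (· * ·) n Z i₀ l (Fin.last n) = 0 ∧
      (∀ k, wordVal (· * ·) n Z i₀ l (Fin.castSucc k) =
        (∏ i, X i k ^ wordHead i₀ l i) *
          ((wordRest i₀ l).map fun q => powerSum q X / n).prod) ∧
      (∑ k, wordVal (· * ·) n Z i₀ l k) / n = wordProd i₀ l X := by
  suffices h : wordVal (· * ·) n Z i₀ l (Fin.last n) = 0 ∧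
      (∀ k, wordVal (· * ·) n Z i₀ l (Fin.castSucc k) =
        (∏ i, X i k ^ wordHead i₀ l i) *
          ((wordRest i₀ l).map fun q => powerSum q X / n).prod) by
    refine ⟨h.1, h.2, ?_⟩
    rw [Fin.sum_univ_castSucc, h.1, Finset.sum_congr rfl fun k _ => h.2 k, ← Finset.sum_mul,
      add_zero, wordProd, List.map_cons, List.prod_cons, powerSum]
    ring
  induction l with
  | nil =>
    refine ⟨hZl i₀, fun k => ?_⟩
    have := prod_pow_single_add (fun i => X i k) i₀ 0
    simp only [add_zero, Pi.zero_apply, pow_zero, Finset.prod_const_one, mul_one] at this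
    simp [wordVal, wordHead, wordRest, hZ, this]
  | cons a l ih =>
    obtain ⟨i, b⟩ := a
    refine ⟨by simp [wordVal, hZl], fun k => ?_⟩
    cases b
    · simp only [wordVal, wordHead, wordRest, Bool.false_eq_true, if_false, hZ, ih.2 k]
      rw [prod_pow_single_add (fun i => X i k), mul_assoc]
    · simp only [wordVal, wordHead, wordRest, if_true, hZ]
      rw [Fin.sum_univ_castSucc, ih.1, Finset.sum_congr rfl fun k _ => ih.2 k, ← Finset.sum_mul,
        prod_pow_single_add (fun i => X i k)]
      simp only [Pi.zero_apply, pow_zero, Finset.prod_const_one, mul_one, add_zero, List.map_cons,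
        List.prod_cons]
      rw [powerSum]
      ring

lemma exists_word {d : ℕ} (t : ℕ) : ∀ (q : Fin d → ℕ) (l : List (Fin d → ℕ)),
    1 ≤ ∑ i, q i → (∀ q' ∈ l, 1 ≤ ∑ i, q' i) → ∑ i, q i + (l.map fun q' => ∑ i, q' i).sum = t + 1 →
    ∃ (i₀ : Fin d) (w : List (Letter d)), wordHead i₀ w = q ∧ wordRest i₀ w = l ∧ w.length = t := by
  induction t with
  | zero =>
    intro q l hq hl ht
    have hl0 : l = [] := by
      cases l with
      | nil => rfl
      | cons a l =>
        have := hl a (by simp)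
        simp only [List.map_cons, List.sum_cons] at ht
        omega
    subst hl0
    obtain ⟨i, -, hi⟩ := Finset.exists_ne_zero_of_sum_ne_zero (Nat.one_le_iff_ne_zero.mp hq)
    have hsum : ∑ k, q k = 1 := by simpa using ht
    refine ⟨i, [], ?_, rfl, rfl⟩
    funext k
    rw [← Finset.add_sum_erase _ _ (Finset.mem_univ i)] at hsum
    by_cases hk : k = i
    · subst hk
      simp only [wordHead, Pi.single_eq_same]
      omega
    · have := Finset.single_le_sum (f := q) (fun _ _ => Nat.zero_le _)
        (Finset.mem_erase.mpr ⟨hk, Finset.mem_univ k⟩)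
      simp only [wordHead, Pi.single_eq_of_ne hk]
      omega
  | succ t ih =>
    intro q l hq hl ht
    obtain ⟨i, -, hi⟩ := Finset.exists_ne_zero_of_sum_ne_zero (Nat.one_le_iff_ne_zero.mp hq)
    obtain ⟨q', rfl⟩ : ∃ q' : Fin d → ℕ, q = Pi.single i 1 + q' := by
      refine ⟨q - Pi.single i 1, (add_tsub_cancel_of_le fun k => ?_).symm⟩
      by_cases hk : k = i
      · subst hk
        simpa using Nat.one_le_iff_ne_zero.mpr hi
      · simp [Pi.single_eq_of_ne hk]
    have hs : ∑ k, (Pi.single i 1 + q' : Fin d → ℕ) k = 1 + ∑ k, q' k := by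
      simp [Finset.sum_add_distrib]
    rw [hs] at ht
    by_cases hq' : 1 ≤ ∑ k, q' k
    · obtain ⟨i₀, w, h1, h2, h3⟩ := ih q' l hq' hl (by omega)
      exact ⟨i₀, (i, false) :: w, by simp [wordHead, h1], by simp [wordRest, h2], by simp [h3]⟩
    · have hq0 : q' = 0 := by
        funext k
        have := Finset.single_le_sum (f := q') (fun _ _ => Nat.zero_le _) (Finset.mem_univ k)
        simp only [Pi.zero_apply]
        omega
      cases l with
      | nil => simp at ht; omega
      | cons a l =>
        simp only [List.map_cons, List.sum_cons] at ht
        obtain ⟨i₀, w, h1, h2, h3⟩ := ih a l (hl a (by simp))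
          (fun q'' h => hl q'' (List.mem_cons_of_mem _ h)) (by omega)
        exact ⟨i₀, (i, true) :: w, by simp [wordHead, hq0], by simp [wordRest, h1, h2],
          by simp [h3]⟩

/-- Words as dependent pairs, to count them. -/
def wordEquiv (d s : ℕ) : Word d s ≃ Fin d × Σ t : Fin s, List.Vector (Letter d) t :=
  (Equiv.refl _).prodCongr
    { toFun := fun l => ⟨⟨l.1.length, l.2⟩, ⟨l.1, rfl⟩⟩
      invFun := fun v => ⟨v.2.1, v.2.2.symm ▸ v.1.2⟩
      left_inv := fun _ => rfl
      right_inv := by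
        rintro ⟨⟨t, ht⟩, ⟨l, hl⟩⟩
        change l.length = t at hl
        subst hl
        rfl }

instance (d s : ℕ) : Fintype (Word d s) := Fintype.ofEquiv _ (wordEquiv d s).symm

lemma card_word_le (d s : ℕ) : Fintype.card (Word d s) ≤ (2 * d) ^ s := by
  rw [Fintype.card_congr (wordEquiv d s), Fintype.card_prod, Fintype.card_sigma]
  simp only [card_vector, Fintype.card_prod, Fintype.card_fin, Fintype.card_bool]
  rw [Fin.sum_univ_eq_sum_range (fun t => (d * 2) ^ t)]
  rcases Nat.eq_zero_or_pos d with rfl | hd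
  · simp
  · induction s with
    | zero => simp
    | succ s ih =>
      rw [Finset.sum_range_succ, mul_add, pow_succ, mul_comm d 2]
      rw [mul_comm d 2] at ih
      nlinarith [Nat.zero_le ((2 * d) ^ s), Nat.mul_le_mul_right ((2 * d) ^ s) hd]

lemma exists_word_coef {d n s : ℕ} (hn : 0 < n) (r : ℕ) :
    ∀ (acc : List (Fin d → ℕ)) (p : Fin r → Fin d → ℕ), (∀ q ∈ acc, 1 ≤ ∑ i, q i) →
      (∀ j, 1 ≤ ∑ i, p j i) → 1 ≤ (acc.map fun q => ∑ i, q i).sum + ∑ j, ∑ i, p j i →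
      (acc.map fun q => ∑ i, q i).sum + ∑ j, ∑ i, p j i ≤ s →
      ∃ c : Word d s → ℝ,
        (∀ w, w.2.1.length + 1 ≠ (acc.map fun q => ∑ i, q i).sum + ∑ j, ∑ i, p j i → c w = 0) ∧
        ∑ w, |c w| ≤ (n : ℝ) ^ acc.length * (n.ascFactorial r : ℝ) ∧
        ∀ X : Matrix (Fin d) (Fin n) ℝ,
          (acc.map fun q => powerSum q X).prod * msym p X = ∑ w, c w * wordProd w.1 w.2.1 X := by
  classical
  induction r with
  | zero =>
    intro acc p hacc _ h1 hs
    cases acc with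
    | nil => simp at h1
    | cons q l =>
      simp only [Finset.univ_eq_empty, Finset.sum_empty, add_zero, List.map_cons,
        List.sum_cons] at h1 hs ⊢
      obtain ⟨i₀, w, hw1, hw2, hw3⟩ := exists_word
        (∑ i, q i + (l.map fun q' => ∑ i, q' i).sum - 1) q l
        (hacc q (by simp)) (fun q' h => hacc q' (List.mem_cons_of_mem _ h)) (by omega)
      refine ⟨Pi.single (i₀, ⟨w, by omega⟩) ((n : ℝ) ^ (l.length + 1)), fun w' hw' => ?_, ?_,
        fun X => ?_⟩
      · refine Pi.single_eq_of_ne (fun h => hw' ?_) _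
        subst h
        simp only
        omega
      · rw [Finset.sum_eq_single (i₀, ⟨w, by omega⟩) _ (by simp)]
        · simp
        · intro w' _ hw'
          rw [Pi.single_eq_of_ne hw', abs_zero]
      · rw [Finset.sum_eq_single (i₀, ⟨w, by omega⟩) _ (by simp)]
        · have hn0 : (n : ℝ) ≠ 0 := by exact_mod_cast hn.ne'
          have hm : msym p X = 1 := by
            simp [msym_eq_sum_embedding]
          have hscale : ∀ l : List (Fin d → ℕ), (l.map fun q => powerSum q X).prod =
              (n : ℝ) ^ l.length * (l.map fun q => powerSum q X / n).prod := by
            intro l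
            induction l with
            | nil => simp
            | cons a l ih =>
              simp only [List.map_cons, List.prod_cons, List.length_cons, ih]
              field_simp
              ring
          rw [Pi.single_eq_same, hm, mul_one, wordProd, hw1, hw2]
          exact hscale (q :: l)
        · intro w' _ hw'
          rw [Pi.single_eq_of_ne hw', zero_mul]
  | succ r ih =>
    intro acc p hacc hp h1 hs
    have hupd : ∀ k, ∑ j, ∑ i, Function.update (Fin.tail p) k (p 0 + Fin.tail p k) j i =
        ∑ j, ∑ i, p j i := by
      intro k
      rw [Fin.sum_univ_succ, ← Finset.add_sum_erase _ _ (Finset.mem_univ k),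
        ← Finset.add_sum_erase _ (fun j : Fin r => ∑ i, p j.succ i) (Finset.mem_univ k)]
      rw [Finset.sum_congr rfl (g := fun j : Fin r => ∑ i, p j.succ i)]
      · simp [Finset.sum_add_distrib, Fin.tail, add_assoc]
      · intro j hj
        rw [Function.update_of_ne (Finset.ne_of_mem_erase hj)]
        rfl
    have hsucc : ((p 0 :: acc).map fun q => ∑ i, q i).sum + ∑ j, ∑ i, Fin.tail p j i =
        (acc.map fun q => ∑ i, q i).sum + ∑ j, ∑ i, p j i := by
      rw [Fin.sum_univ_succ]
      simp only [List.map_cons, List.sum_cons, Fin.tail]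
      omega
    obtain ⟨c₁, hc₁, hb₁, he₁⟩ := ih (p 0 :: acc) (Fin.tail p)
      (by simpa using ⟨hp 0, hacc⟩) (fun j => hp j.succ) (by rw [hsucc]; exact h1)
      (by rw [hsucc]; exact hs)
    have h₂ := fun k => ih acc (Function.update (Fin.tail p) k (p 0 + Fin.tail p k)) hacc
      (fun j => by
        by_cases hj : j = k
        · subst hj
          simp only [Function.update_self, Pi.add_apply, Finset.sum_add_distrib]
          exact le_add_right (hp 0)
        · rw [Function.update_of_ne hj]
          exact hp j.succ) (by rw [hupd]; exact h1) (by rw [hupd]; exact hs)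
    choose c₂ hc₂ hb₂ he₂ using h₂
    refine ⟨fun w => c₁ w - ∑ k, c₂ k w, fun w hw => ?_, ?_, fun X => ?_⟩
    · change c₁ w - ∑ k, c₂ k w = 0
      rw [hc₁ w (by rw [hsucc]; exact hw),
        Finset.sum_eq_zero fun k _ => hc₂ k w (by rw [hupd]; exact hw), sub_zero]
    · calc ∑ w, |c₁ w - ∑ k, c₂ k w| ≤ ∑ w, (|c₁ w| + ∑ k, |c₂ k w|) :=
            Finset.sum_le_sum fun w _ => (abs_sub _ _).trans
              (add_le_add_right (Finset.abs_sum_le_sum_abs _ _) _)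
        _ = ∑ w, |c₁ w| + ∑ k, ∑ w, |c₂ k w| := by
            rw [Finset.sum_add_distrib, Finset.sum_comm]
        _ ≤ (n : ℝ) ^ (acc.length + 1) * (n.ascFactorial r : ℝ) +
            ∑ _k : Fin r, (n : ℝ) ^ acc.length * (n.ascFactorial r : ℝ) :=
            add_le_add hb₁ (Finset.sum_le_sum fun k _ => hb₂ k)
        _ = _ := by
            simp only [Finset.sum_const, Finset.card_univ, Fintype.card_fin, nsmul_eq_mul,
              Nat.ascFactorial_succ]
            push_cast
            ring
    · have := he₁ X
      rw [List.map_cons, List.prod_cons] at this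
      simp only [sub_mul, Finset.sum_sub_distrib, Finset.sum_mul]
      rw [← this, Finset.sum_comm, ← Finset.sum_congr rfl fun k _ => he₂ k X, ← Finset.mul_sum,
        msym_succ]
      ring

/-- Approximate multiplication yields approximate word values, with linearly growing error. -/
lemma wordVal_approx {d n : ℕ} (hn : 0 < n) {μ : ℝ → ℝ → ℝ} {ε : ℝ} (h0 : ∀ y, μ 0 y = 0)
    (hμ : ∀ x ∈ Set.Icc (0 : ℝ) 1, ∀ y ∈ Set.Icc (0 : ℝ) 1,
      μ x y ∈ Set.Icc (0 : ℝ) 1 ∧ |μ x y - x * y| ≤ ε)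
    {Z : Fin d → Fin (n + 1) → ℝ} (hZ : ∀ i j, Z i j ∈ Set.Icc (0 : ℝ) 1)
    (hZl : ∀ i, Z i (Fin.last n) = 0) (i₀ : Fin d) (l : List (Letter d)) :
    |(∑ k, wordVal μ n Z i₀ l k) / n - (∑ k, wordVal (· * ·) n Z i₀ l k) / n| ≤ l.length * ε := by
  have hn' : (0 : ℝ) < n := by exact_mod_cast hn
  have havg : ∀ {f g : Fin (n + 1) → ℝ} {δ : ℝ}, f (Fin.last n) = 0 → g (Fin.last n) = 0 →
      (∀ j, |f j - g j| ≤ δ) → |(∑ k, f k) / n - (∑ k, g k) / n| ≤ δ := by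
    intro f g δ hf hg h
    rw [← sub_div, Fin.sum_univ_castSucc, Fin.sum_univ_castSucc, hf, hg, add_zero, add_zero,
      ← Finset.sum_sub_distrib, abs_div, Nat.abs_cast, div_le_iff₀ hn']
    refine (Finset.abs_sum_le_sum_abs _ _).trans ((Finset.sum_le_sum fun k _ => h _).trans ?_)
    simp [mul_comm]
  have hmem : ∀ {f : Fin (n + 1) → ℝ}, f (Fin.last n) = 0 → (∀ j, f j ∈ Set.Icc (0 : ℝ) 1) →
      (∑ k, f k) / n ∈ Set.Icc (0 : ℝ) 1 := by
    intro f hf h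
    refine ⟨div_nonneg (Finset.sum_nonneg fun k _ => (h k).1) hn'.le, ?_⟩
    rw [div_le_one hn', Fin.sum_univ_castSucc, hf, add_zero]
    exact (Finset.sum_le_sum fun k _ => (h _).2).trans (by simp)
  have hl : ∀ ν : ℝ → ℝ → ℝ, (∀ y, ν 0 y = 0) → wordVal ν n Z i₀ l (Fin.last n) = 0 := by
    intro ν hν
    cases l with
    | nil => exact hZl i₀
    | cons a l => rw [wordVal, hZl, hν]
  refine havg (hl _ h0) (hl _ zero_mul) fun j => ?_
  suffices h : ∀ j, wordVal μ n Z i₀ l j ∈ Set.Icc (0 : ℝ) 1 ∧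
      |wordVal μ n Z i₀ l j - wordVal (· * ·) n Z i₀ l j| ≤ l.length * ε from (h j).2
  clear j
  induction l with
  | nil => exact fun j => ⟨hZ i₀ j, by simp [wordVal]⟩
  | cons a l ih =>
    have hl' : ∀ ν : ℝ → ℝ → ℝ, (∀ y, ν 0 y = 0) → wordVal ν n Z i₀ l (Fin.last n) = 0 := by
      intro ν hν
      cases l with
      | nil => exact hZl i₀
      | cons a l => rw [wordVal, hZl, hν]
    specialize ih hl'
    intro j
    have hy : ∃ y y' : ℝ, wordVal μ n Z i₀ (a :: l) j = μ (Z a.1 j) y ∧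
        wordVal (· * ·) n Z i₀ (a :: l) j = Z a.1 j * y' ∧ y ∈ Set.Icc (0 : ℝ) 1 ∧
        |y - y'| ≤ l.length * ε := by
      refine ⟨_, _, rfl, rfl, ?_⟩
      split_ifs
      · exact ⟨hmem (hl' _ h0) fun k => (ih k).1, havg (hl' _ h0) (hl' _ zero_mul) fun k => (ih k).2⟩
      · exact ih j
    obtain ⟨y, y', e1, e2, hy, hyy⟩ := hy
    obtain ⟨m1, m2⟩ := hμ _ (hZ a.1 j) y hy
    rw [e1, e2]
    refine ⟨m1, (abs_sub_le _ (Z a.1 j * y) _).trans ?_⟩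
    have h3 : |Z a.1 j * y - Z a.1 j * y'| ≤ |y - y'| := by
      rw [← mul_sub, abs_mul, abs_of_nonneg (hZ a.1 j).1]
      exact mul_le_of_le_one_left (abs_nonneg _) (hZ a.1 j).2
    rw [List.length_cons]
    push_cast
    linarith

/-! ### Networks acting on states indexed by an arbitrary finite type of rows -/

/-- Some single-head network of width `W` and depth `k` maps the state `S i` to `S' i`, for
all `i`. -/
def Reach {R ι : Type*} {D m : ℕ} (e : R ≃ Fin D) (W k : ℕ) (S S' : ι → R → Fin m → ℝ) : Prop :=
  ∃ net : List (TransformerBlock D),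
    (∀ B ∈ net, B.attn.m ≤ W ∧ B.ff.r ≤ W ∧ B.attn.h = 1) ∧ net.length = k ∧
      ∀ i, applyNet net (Matrix.of fun a j => S i (e.symm a) j) =
        Matrix.of fun a j => S' i (e.symm a) j

lemma Reach.refl {R ι : Type*} {D m W : ℕ} (e : R ≃ Fin D) (S : ι → R → Fin m → ℝ) :
    Reach e W 0 S S :=
  ⟨[], by simp, rfl, fun _ => rfl⟩

lemma Reach.trans {R ι : Type*} {D m W k l : ℕ} {e : R ≃ Fin D} {S S' S'' : ι → R → Fin m → ℝ}
    (h : Reach e W k S S') (h' : Reach e W l S' S'') : Reach e W (k + l) S S'' := by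
  obtain ⟨u, hu, hk, hS⟩ := h
  obtain ⟨v, hv, hl, hS'⟩ := h'
  refine ⟨u ++ v, fun B hB => (List.mem_append.mp hB).elim (hu B) (hv B), by simp [hk, hl],
    fun i => ?_⟩
  rw [applyNet, List.foldl_append, ← applyNet, ← applyNet, hS, hS']

/-- Attention with vanishing keys and queries adds linear images of the sum of all columns. -/
lemma reach_attention {R ι : Type*} [Fintype R] {D m W : ℕ} (hm : 0 < m) (e : R ≃ Fin D)
    (hD : D ≤ W) (C : R → R → ℝ) {S S' : ι → R → Fin m → ℝ}
    (h : ∀ i a j, S' i a j = S i a j + ∑ b, C a b * ∑ k, S i b k) : Reach e W 1 S S' := by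
  refine ⟨[{ attn := { m := D, h := 1,
                       WO := fun _ => Matrix.of fun a b => m * C (e.symm a) (e.symm b),
                       WV := fun _ => 1, WK := fun _ => 0, WQ := fun _ => 0 },
             ff := { r := 0, W1 := 0, W2 := 0, b1 := 0, b2 := 0 } }], ?_, rfl, fun i => ?_⟩
  · simpa using hD
  · have hm' : (m : ℝ) ≠ 0 := by exact_mod_cast hm.ne'
    have hsoft : softmax (0 : Matrix (Fin m) (Fin m) ℝ) = Matrix.of fun _ _ => (1 / m : ℝ) := by
      ext
      simp [softmax]
    ext a j
    simp only [applyNet, List.foldl_cons, List.foldl_nil, TransformerBlock.apply, FFLayer.apply,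
      AttnLayer.apply, Fin.sum_univ_one, Matrix.one_mul, Matrix.zero_mul, Matrix.mul_zero, hsoft,
      Matrix.add_apply, Matrix.mul_apply, Matrix.of_apply, Pi.zero_apply,
      add_zero, h]
    congr 1
    rw [← Equiv.sum_comp e]
    refine Finset.sum_congr rfl fun b _ => ?_
    rw [Equiv.symm_apply_apply, ← Finset.sum_mul]
    field_simp

/-- A feed-forward layer with hidden units indexed by an arbitrary finite type. -/
lemma reach_feedForward {R H ι : Type*} [Fintype R] [Fintype H] {D m W : ℕ} (e : R ≃ Fin D)
    (hH : Fintype.card H ≤ W) (W1 : H → R → ℝ) (b : H → ℝ) (W2 : R → H → ℝ)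
    {S S' : ι → R → Fin m → ℝ}
    (h : ∀ i a j, S' i a j = S i a j + ∑ u, W2 a u * relu (∑ a', W1 u a' * S i a' j + b u)) :
    Reach e W 1 S S' := by
  have f := Fintype.equivFin H
  refine ⟨[{ attn := { m := 0, h := 1, WO := fun _ => 0, WV := fun _ => 0, WK := fun _ => 0,
                       WQ := fun _ => 0 },
             ff := { r := Fintype.card H,
                     W1 := Matrix.of fun u a => W1 (f.symm u) (e.symm a),
                     W2 := Matrix.of fun a u => W2 (e.symm a) (f.symm u),
                     b1 := fun u => b (f.symm u), b2 := 0 } }], ?_, rfl, fun i => ?_⟩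
  · simpa using hH
  · ext a j
    simp only [applyNet, List.foldl_cons, List.foldl_nil, TransformerBlock.apply, FFLayer.apply,
      AttnLayer.apply, Matrix.add_apply, Matrix.mul_apply, Matrix.of_apply, Finset.sum_const_zero,
      Matrix.zero_mul, Matrix.zero_apply, Pi.zero_apply, add_zero, reluM, h]
    congr 1
    rw [← Equiv.sum_comp f]
    refine Finset.sum_congr rfl fun u _ => ?_
    rw [← Equiv.sum_comp e]
    simp only [Equiv.symm_apply_apply]

/-! ### The network computing approximate word values -/

/-- The input coordinates, six working rows for each word, and an output row for each word. -/
abbrev Row (d s : ℕ) := Fin d ⊕ (Word d s × Fin 6) ⊕ Word d s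

instance (d s : ℕ) : DecidableEq (Word d s) := inferInstance

/-- The most recent letter of a word (a default one for words without letters). -/
def Word.letter {d s : ℕ} (w : Word d s) : Letter d := w.2.1.headD (w.1, false)

/-- The word with its most recent letter removed. -/
def Word.parent {d s : ℕ} (w : Word d s) : Word d s :=
  (w.1, ⟨w.2.1.tail, by have := w.2.2; rw [List.length_tail]; omega⟩)

/-- The row holding the value of a word. -/
def Word.valRow {d s : ℕ} (w : Word d s) : Row d s :=
  if w.2.1 = [] then .inl w.1 else .inr (.inl (w, 0))

/-- The row holding the second factor in the last multiplication of a word. -/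
def Word.operandRow {d s : ℕ} (w : Word d s) : Row d s :=
  if w.letter.2 then .inr (.inl (w, 1)) else w.parent.valRow

section Stages

variable (N L n : ℕ) {d s : ℕ}

/-- The computed value of a word. -/
noncomputable def approxVal (Z : Fin d → Fin (n + 1) → ℝ) (w : Word d s) : Fin (n + 1) → ℝ :=
  wordVal (mulApprox N L) n Z w.1 w.2.1

/-- The second factor in the last multiplication of a word. -/
noncomputable def operand (Z : Fin d → Fin (n + 1) → ℝ) (w : Word d s) (j : Fin (n + 1)) : ℝ :=
  if w.letter.2 then (∑ k, approxVal N L n Z w.parent k) / n else approxVal N L n Z w.parent j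

/-- The working rows of a word, when its value row holds `y` and `k` layers of its last
multiplication are done. -/
noncomputable def workRows (k : ℕ) (y : ℝ) (Z : Fin d → Fin (n + 1) → ℝ) (w : Word d s)
    (j : Fin (n + 1)) : Fin 6 → ℝ :=
  ![y, (∑ k, approxVal N L n Z w.parent k) / n,
    (zigzag N)^[k] (relu (Z w.letter.1 j)),
    (zigzag N)^[k] (relu (operand N L n Z w j)),
    (zigzag N)^[k] (relu ((Z w.letter.1 j + operand N L n Z w j) / 2)),
    mulAcc N (Z w.letter.1 j) (operand N L n Z w j) k]

/-- The state in which the words with fewer than `t` letters are finished, the working rows of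
those with `t` letters are given by `v`, and everything else is blank. -/
noncomputable def stageState (t : ℕ)
    (v : (Fin d → Fin (n + 1) → ℝ) → Word d s → Fin (n + 1) → Fin 6 → ℝ)
    (Z : Fin d → Fin (n + 1) → ℝ) : Row d s → Fin (n + 1) → ℝ
  | .inl i, j => Z i j
  | .inr (.inl (w, c)), j =>
      if w.2.1.length = 0 then 0
      else if w.2.1.length < t then workRows N L n L (approxVal N L n Z w j) Z w j c
      else if w.2.1.length = t then v Z w j c else 0
  | .inr (.inr _), _ => 0

variable {N L n}

lemma approxVal_eq (Z : Fin d → Fin (n + 1) → ℝ) {w : Word d s} (hw : w.2.1.length ≠ 0)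
    (j : Fin (n + 1)) :
    approxVal N L n Z w j = mulApprox N L (Z w.letter.1 j) (operand N L n Z w j) := by
  obtain ⟨i₀, ⟨_ | ⟨a, l⟩, hl⟩⟩ := w
  · exact absurd rfl hw
  · rfl

lemma length_parent {w : Word d s} : w.parent.2.1.length = w.2.1.length - 1 :=
  List.length_tail

variable {t : ℕ} (v : (Fin d → Fin (n + 1) → ℝ) → Word d s → Fin (n + 1) → Fin 6 → ℝ)
  (Z : Fin d → Fin (n + 1) → ℝ)

lemma stageState_valRow {w : Word d s} (hw : w.2.1.length < t) (j : Fin (n + 1)) :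
    stageState N L n t v Z w.valRow j = approxVal N L n Z w j := by
  obtain ⟨i₀, ⟨_ | ⟨a, l⟩, hl⟩⟩ := w
  · rfl
  · rw [Word.valRow, if_neg (by simp), stageState, if_neg (by simp), if_pos hw]
    rfl

lemma stageState_working {w : Word d s} (ht : 1 ≤ t) (hw : w.2.1.length = t) (c : Fin 6)
    (j : Fin (n + 1)) : stageState N L n t v Z (.inr (.inl (w, c))) j = v Z w j c := by
  rw [stageState, if_neg (by omega), if_neg (by omega), if_pos hw]

lemma stageState_finished :
    stageState N L n t (fun Z (w : Word d s) j => workRows N L n L (approxVal N L n Z w j) Z w j) =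
      stageState N L n (t + 1) 0 := by
  funext Z a j
  rcases a with i | ⟨w, c⟩ | w
  · rfl
  · simp only [stageState, Pi.zero_apply]
    split_ifs <;> first | rfl | omega
  · rfl

variable {v} {D W : ℕ} {e : Row d s ≃ Fin D}

/-- A feed-forward layer acting in the same way on the working rows of all words with `t`
letters. -/
lemma reach_working {K : Type*} [Fintype K] (hK : Fintype.card K * (2 * d) ^ s ≤ W) (ht : 1 ≤ t)
    (M : Fin 6 → K → ℝ) (W1 : Word d s → K → Row d s → ℝ) (b : K → ℝ)
    {v' : (Fin d → Fin (n + 1) → ℝ) → Word d s → Fin (n + 1) → Fin 6 → ℝ}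
    (h : ∀ Z (w : Word d s) j c, w.2.1.length = t → v' Z w j c = v Z w j c +
      ∑ k, M c k * relu (∑ a, W1 w k a * stageState N L n t v Z a j + b k)) :
    Reach e W 1 (stageState N L n t v) (stageState N L n t v') := by
  classical
  refine reach_feedForward (H := Word d s × K) e ?_ (fun u => W1 u.1 u.2) (fun u => b u.2)
    (fun a u => match a with
      | .inr (.inl (w, c)) => if u.1 = w then if w.2.1.length = t then M c u.2 else 0 else 0
      | _ => 0) fun Z a j => ?_
  · rw [Fintype.card_prod, mul_comm]
    exact (Nat.mul_le_mul_left _ (card_word_le d s)).trans hK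
  · rcases a with i | ⟨w, c⟩ | w
    · simp [stageState]
    · simp only [Fintype.sum_prod_type, ite_mul, zero_mul]
      rw [Finset.sum_comm]
      simp only [Finset.sum_ite_eq', Finset.mem_univ, if_true]
      by_cases hw : w.2.1.length = t
      · simp only [hw, if_true]
        rw [stageState_working _ _ ht hw, stageState_working _ _ ht hw]
        exact h Z w j c hw
      · simp [stageState, hw]
    · simp [stageState]

lemma reach_average (hD : D ≤ W) (ht : 1 ≤ t) :
    Reach e W 1 (stageState N L n t 0) (stageState N L n t fun Z (w : Word d s) _ =>
      ![0, (∑ k, approxVal N L n Z w.parent k) / n, 0, 0, 0, 0]) := by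
  refine reach_attention n.succ_pos e hD (fun a b => match a with
    | .inr (.inl (w, c)) =>
      if b = w.parent.valRow then if w.2.1.length = t ∧ c = 1 then (1 / n : ℝ) else 0 else 0
    | _ => 0) fun Z a j => ?_
  rcases a with i | ⟨w, c⟩ | w
  · simp [stageState]
  · simp only [ite_mul, zero_mul, Finset.sum_ite_eq', Finset.mem_univ, if_true]
    by_cases hw : w.2.1.length = t
    · rw [stageState_working _ _ ht hw, stageState_working _ _ ht hw]
      simp only [stageState_valRow _ _ (show w.parent.2.1.length < t by rw [length_parent]; omega)]
      fin_cases c <;> simp [hw, div_eq_inv_mul]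
    · simp [stageState, hw]
  · simp [stageState]

lemma stageState_operandRow {w : Word d s} (ht : 1 ≤ t) (hw : w.2.1.length = t)
    (hv : ∀ j, v Z w j 1 = (∑ k, approxVal N L n Z w.parent k) / n) (j : Fin (n + 1)) :
    stageState N L n t v Z w.operandRow j = operand N L n Z w j := by
  rw [Word.operandRow, operand]
  split_ifs
  · rw [stageState_working _ _ ht hw, hv]
  · exact stageState_valRow _ _ (by rw [length_parent]; omega) j

lemma reach_load (hW : 3 * (2 * d) ^ s ≤ W) (ht : 1 ≤ t) :
    Reach e W 1 (stageState N L n t fun Z (w : Word d s) _ =>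
      ![0, (∑ k, approxVal N L n Z w.parent k) / n, 0, 0, 0, 0])
      (stageState N L n t (workRows N L n 0 0)) := by
  refine reach_working (K := Fin 3) (by simpa using hW) ht
    !![0, 0, 0; 0, 0, 0; 1, 0, 0; 0, 1, 0; 0, 0, 1; 0, 0, 1]
    (fun w k a => ![if a = .inl w.letter.1 then 1 else 0, if a = w.operandRow then 1 else 0,
      (1 / 2) * ((if a = .inl w.letter.1 then 1 else 0) + if a = w.operandRow then 1 else 0)] k)
    0 fun Z w j c hw => ?_
  have ho := stageState_operandRow (N := N) (L := L) (v := fun Z (w : Word d s) _ =>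
      ![0, (∑ k, approxVal N L n Z w.parent k) / n, 0, 0, 0, 0]) Z ht hw (fun _ => rfl) j
  simp only [Fin.sum_univ_three, Matrix.cons_val_zero, Matrix.cons_val_one, Matrix.cons_val,
    mul_assoc, add_mul, ← Finset.mul_sum, Finset.sum_add_distrib, ite_mul, one_mul, zero_mul,
    Finset.sum_ite_eq', Finset.mem_univ, if_true, ho, Pi.zero_apply, add_zero]
  fin_cases c <;> simp [workRows, stageState, mulAcc, div_eq_inv_mul]

lemma reach_zigzag (hW : 3 * N * (2 * d) ^ s ≤ W) (ht : 1 ≤ t) (i : ℕ) :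
    Reach e W 1 (stageState N L n t (workRows (s := s) N L n i 0))
      (stageState N L n t (workRows N L n (i + 1) 0)) := by
  refine reach_working (K := Fin 3 × Fin N) (by simpa using hW) ht
    (fun c u => (if c = ![2, 3, 4] u.1 then zigzagCoef N u.2 else 0) +
      if c = 5 then (1 / (N : ℝ) ^ 2) ^ i * ![1 / 2, 1 / 2, -2] u.1 * hatCoef N u.2 else 0)
    (fun w u a => if a = .inr (.inl (w, ![2, 3, 4] u.1)) then 1 else 0)
    (fun u => -(u.2 / N : ℝ)) fun Z w j c hw => ?_
  simp only [ite_mul, one_mul, zero_mul, Finset.sum_ite_eq', Finset.mem_univ, if_true,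
    stageState_working _ _ ht hw, ← sub_eq_add_neg, Fintype.sum_prod_type, Fin.sum_univ_three]
  fin_cases c
  · simp [workRows]
  · simp [workRows]
  · simp [workRows, Function.iterate_succ_apply', zigzag]
  · simp [workRows, Function.iterate_succ_apply', zigzag]
  · simp [workRows, Function.iterate_succ_apply', zigzag]
  · simp [workRows, mulAcc, Finset.sum_range_succ, hat, mul_assoc, ← Finset.mul_sum]
    ring

lemma reach_clip (hW : 2 * (2 * d) ^ s ≤ W) (ht : 1 ≤ t) :
    Reach e W 1 (stageState N L n t (workRows (s := s) N L n L 0))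
      (stageState N L n (t + 1) 0) := by
  rw [← stageState_finished]
  refine reach_working (K := Fin 2) (by simpa using hW) ht
    (fun c k => if c = 0 then ![1, -1] k else 0)
    (fun w k a => ![if a = .inr (.inl (w, 5)) then 1 else 0,
      (if a = .inr (.inl (w, 5)) then 1 else 0) - if a = .inl w.letter.1 then 1 else 0] k)
    0 fun Z w j c hw => ?_
  simp only [Fin.sum_univ_two, Matrix.cons_val_zero, Matrix.cons_val_one, sub_mul, ite_mul,
    one_mul, zero_mul, Finset.sum_sub_distrib, Finset.sum_ite_eq', Finset.mem_univ, if_true,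
    stageState_working _ _ ht hw, Pi.zero_apply, add_zero]
  rw [approxVal_eq Z (by omega)]
  fin_cases c <;> simp [workRows, mulApprox, stageState, sub_eq_add_neg]

lemma reach_stage (hN : 0 < N) (hD : D ≤ W) (hW : 3 * N * (2 * d) ^ s ≤ W) (ht : 1 ≤ t) :
    Reach e W (L + 3) (stageState (s := s) N L n t 0) (stageState N L n (t + 1) 0) := by
  have h3 : 3 * (2 * d) ^ s ≤ W :=
    (Nat.mul_le_mul_right _ (Nat.le_mul_of_pos_right 3 hN)).trans hW
  have hzig : ∀ k, Reach e W k (stageState N L n t (workRows (s := s) N L n 0 0))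
      (stageState N L n t (workRows N L n k 0)) := by
    intro k
    induction k with
    | zero => exact Reach.refl _ _
    | succ k ih => exact ih.trans (reach_zigzag hW ht k)
  have := (((reach_average hD ht).trans (reach_load h3 ht)).trans (hzig L)).trans
    (reach_clip ((Nat.mul_le_mul_right _ (by norm_num)).trans h3) ht)
  rwa [show 1 + 1 + L + 1 = L + 3 by ring] at this

/-- The final state, with linear combinations of the averaged word values in the output rows. -/
noncomputable def outputState (N L n : ℕ) (c : Word d s → Word d s → ℝ)
    (Z : Fin d → Fin (n + 1) → ℝ) : Row d s → Fin (n + 1) → ℝ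
  | .inr (.inr w), _ => ∑ w', c w w' * ((∑ k, approxVal N L n Z w' k) / n)
  | a, j => stageState N L n s 0 Z a j

lemma reach_output (hN : 0 < N) (hD : D ≤ W) (hW : 3 * N * (2 * d) ^ s ≤ W) (hs : 0 < s)
    (c : Word d s → Word d s → ℝ) :
    Reach e W ((s - 1) * (L + 3) + 1) (stageState (s := s) N L n 1 0) (outputState N L n c) := by
  have hst : ∀ t, Reach e W (t * (L + 3)) (stageState (s := s) N L n 1 0)
      (stageState N L n (t + 1) 0) := by
    intro t
    induction t with
    | zero => simpa using Reach.refl _ _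
    | succ t ih =>
      rw [add_mul, one_mul]
      exact ih.trans (reach_stage hN hD hW (by omega))
  have hlast := hst (s - 1)
  rw [Nat.sub_add_cancel hs] at hlast
  refine hlast.trans (reach_attention n.succ_pos e hD (fun a b => match a with
    | .inr (.inr w) => ∑ w' : Word d s, if b = w'.valRow then c w w' / n else 0
    | _ => 0) fun Z a j => ?_)
  rcases a with i | ⟨w, c⟩ | w
  · simp [outputState]
  · simp [outputState]
  · simp only [outputState, Finset.sum_mul]
    rw [Finset.sum_comm]
    simp only [ite_mul, zero_mul, Finset.sum_ite_eq', Finset.mem_univ, if_true,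
      fun w' : Word d s => stageState_valRow (N := N) (L := L) (0 : (Fin d → Fin (n + 1) → ℝ) →
        Word d s → Fin (n + 1) → Fin 6 → ℝ) Z w'.2.2]
    simp only [stageState, zero_add]
    exact Finset.sum_congr rfl fun w' _ => by ring

end Stages

/-! ### Designated outputs and the error bound -/

lemma exists_word_ofFn {d s r : ℕ} {p : Fin r → Fin d → ℕ} (hr : 1 ≤ r)
    (hp : ∀ j, 1 ≤ ∑ i, p j i) (hs : ∑ j, ∑ i, p j i ≤ s) :
    ∃ w : Word d s, List.ofFn p = wordHead w.1 w.2.1 :: wordRest w.1 w.2.1 := by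
  obtain ⟨r, rfl⟩ := Nat.exists_eq_add_of_le' hr
  have h0 := hp 0
  rw [Fin.sum_univ_succ] at hs
  have hsum : ((List.ofFn fun j : Fin r => p j.succ).map fun q => ∑ i, q i).sum =
      ∑ j : Fin r, ∑ i, p j.succ i := by
    rw [List.map_ofFn, List.sum_ofFn]
    rfl
  obtain ⟨i₀, w, h1, h2, h3⟩ := exists_word
    (∑ i, p 0 i + ∑ j : Fin r, ∑ i, p j.succ i - 1) (p 0) (List.ofFn fun j : Fin r => p j.succ)
    h0 (by simpa [List.mem_ofFn] using fun j : Fin r => hp j.succ) (by rw [hsum]; omega)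
  exact ⟨(i₀, ⟨w, by omega⟩), by rw [List.ofFn_succ, h1, h2]⟩

lemma exists_output_coef {d s n : ℕ} (hn : 0 < n) (w : Word d s) :
    ∃ c : Word d s → ℝ, ∀ r (p : Fin r → Fin d → ℕ), 1 ≤ r →
      (∀ j, 1 ≤ ∑ i, p j i) → ∑ j, ∑ i, p j i ≤ s →
      List.ofFn p = wordHead w.1 w.2.1 :: wordRest w.1 w.2.1 →
      (∀ w', w'.2.1.length + 1 ≠ ∑ j, ∑ i, p j i → c w' = 0) ∧
      ∑ w', |c w'| ≤ n.ascFactorial r ∧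
      ∀ X : Matrix (Fin d) (Fin n) ℝ, msym p X = ∑ w', c w' * wordProd w'.1 w'.2.1 X := by
  by_cases h : ∃ r, ∃ p : Fin r → Fin d → ℕ, 1 ≤ r ∧ (∀ j, 1 ≤ ∑ i, p j i) ∧
      ∑ j, ∑ i, p j i ≤ s ∧ List.ofFn p = wordHead w.1 w.2.1 :: wordRest w.1 w.2.1
  · obtain ⟨r, p, hr, hp, hs, hw⟩ := h
    have h1 : 1 ≤ ∑ j, ∑ i, p j i := (hp ⟨0, hr⟩).trans
      (Finset.single_le_sum (f := fun j => ∑ i, p j i) (fun _ _ => Nat.zero_le _)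
        (Finset.mem_univ _))
    obtain ⟨c, hc⟩ := exists_word_coef hn r [] p (by simp) hp (by simpa using h1)
      (by simpa using hs)
    refine ⟨c, fun r' p' _ _ _ hw' => ?_⟩
    cases List.ofFn_inj'.mp (hw.trans hw'.symm)
    simpa using hc
  · exact ⟨0, fun r p hr hp hs hw => absurd ⟨r, p, hr, hp, hs, hw⟩ h⟩

lemma one_add_sum_le_prod_add_one {r : ℕ} (a : Fin r → ℕ) : 1 + ∑ j, a j ≤ ∏ j, (a j + 1) := by
  induction r with
  | zero => simp
  | succ r ih =>
    rw [Fin.sum_univ_succ, Fin.prod_univ_succ]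
    nlinarith [ih fun j => a j.succ, Nat.zero_le (∑ j : Fin r, a j.succ)]

lemma ascFactorial_mul_sum_le {n r : ℕ} (a : Fin r → ℕ) :
    (n.ascFactorial r : ℝ) * (∑ j, a j : ℕ) ≤
      ((n + r - 1).descFactorial r : ℝ) * ∏ j, ((a j : ℝ) + 1) - (n : ℝ) ^ r := by
  rw [Nat.add_descFactorial_eq_ascFactorial' n r]
  have h1 : ((1 + ∑ j, a j : ℕ) : ℝ) ≤ (∏ j, (a j + 1) : ℕ) :=
    Nat.cast_le.mpr (one_add_sum_le_prod_add_one a)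
  have h2 : (n : ℝ) ^ r ≤ n.ascFactorial r := by
    exact_mod_cast Nat.pow_succ_le_ascFactorial n r
  have h3 := mul_le_mul_of_nonneg_left h1 (Nat.cast_nonneg (α := ℝ) (n.ascFactorial r))
  push_cast at h3 ⊢
  linarith

/-- There is a single-head Transformer network `T` of width at most `12·(2d)^s·N`
and depth at most `(s−1)(2L+3)+1` such that, feeding it `X ∈ [0,1]^{d×n}` embedded
in the top-left block (zeros elsewhere), designated coordinates of the `(n+1)`-st
output column approximate every monomial column-symmetric polynomial
`m_{p_1,…,p_r}` with `1 ≤ r ≤ s`, `|p_j| ≥ 1` and `|p_1|+⋯+|p_r| ≤ s`, with error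
at most `(P(n+r−1,r)·(|p_1|+1)⋯(|p_r|+1) − n^r)·N^{−L}`, where `P(a,b) = a!/(a−b)!`. -/
theorem stmt3 (d n s N L : ℕ) (hd : 0 < d) (hn : 0 < n) (hs : 0 < s)
    (hN : 0 < N) (hL : 0 < L) :
    ∃ (d' : ℕ) (net : List (TransformerBlock d'))
      (idx : (r : ℕ) → (Fin r → Fin d → ℕ) → Fin d'),
      d' ≤ 12 * (2*d)^s * N ∧
      (∀ B ∈ net, B.attn.m ≤ 12 * (2*d)^s * N ∧ B.ff.r ≤ 12 * (2*d)^s * N) ∧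
      net.length ≤ (s-1)*(2*L+3) + 1 ∧
      (∀ B ∈ net, B.attn.h = 1) ∧
      ∀ (r : ℕ), 1 ≤ r → r ≤ s → ∀ p : Fin r → Fin d → ℕ,
        (∀ j, 1 ≤ ∑ i, p j i) → (∑ j, ∑ i, p j i) ≤ s →
        ∀ X : Matrix (Fin d) (Fin n) ℝ, (∀ i j, X i j ∈ Set.Icc (0:ℝ) 1) →
          |applyNet net (embed d' (n+1) X) (idx r p) (Fin.last n) - msym p X| ≤
            (((n + r - 1).descFactorial r : ℝ) *
                (∏ j, (((∑ i, p j i : ℕ) : ℝ) + 1)) - (n : ℝ)^r) / (N : ℝ)^L := by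
  choose c hc using exists_output_coef (d := d) (s := s) hn
  have henc : ∀ (r : ℕ) (p : Fin r → Fin d → ℕ), ∃ w : Word d s,
      1 ≤ r → (∀ j, 1 ≤ ∑ i, p j i) → ∑ j, ∑ i, p j i ≤ s →
        List.ofFn p = wordHead w.1 w.2.1 :: wordRest w.1 w.2.1 := by
    intro r p
    by_cases h : 1 ≤ r ∧ (∀ j, 1 ≤ ∑ i, p j i) ∧ ∑ j, ∑ i, p j i ≤ s
    · exact (exists_word_ofFn h.1 h.2.1 h.2.2).imp fun _ hw _ _ _ => hw
    · exact ⟨(⟨0, hd⟩, ⟨[], hs⟩), fun h1 h2 h3 => absurd ⟨h1, h2, h3⟩ h⟩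
  choose enc henc using henc
  let e : Row d s ≃ Fin (d + Fintype.card ((Word d s × Fin 6) ⊕ Word d s)) :=
    ((Equiv.refl _).sumCongr (Fintype.equivFin _)).trans finSumFinEquiv
  have hpow : (2 * d) ^ s ≤ (2 * d) ^ s * N := Nat.le_mul_of_pos_right _ hN
  have hD : d + Fintype.card ((Word d s × Fin 6) ⊕ Word d s) ≤ 12 * (2 * d) ^ s * N := by
    have h1 : 2 * d ≤ (2 * d) ^ s := Nat.le_self_pow hs.ne' _
    have h2 := card_word_le d s
    rw [Fintype.card_sum, Fintype.card_prod, Fintype.card_fin, mul_assoc]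
    omega
  obtain ⟨net, hnet, hlen, hout⟩ := reach_output (n := n) (L := L) (e := e) hN hD
    (by rw [mul_assoc, mul_assoc, mul_comm N]; omega) hs c
  refine ⟨_, net, fun r p => e (.inr (.inr (enc r p))), hD,
    fun B hB => ⟨(hnet B hB).1, (hnet B hB).2.1⟩, ?_, fun B hB => (hnet B hB).2.2,
    fun r hr _ p hp hps X hX => ?_⟩
  · rw [hlen]
    gcongr
    omega
  let Z : Fin d → Fin (n + 1) → ℝ := fun i => Fin.snoc (X i) 0
  have hZ : ∀ i k, Z i (Fin.castSucc k) = X i k := fun i k => Fin.snoc_castSucc ..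
  have hZl : ∀ i, Z i (Fin.last n) = 0 := fun i => Fin.snoc_last ..
  have hZm : ∀ i j, Z i j ∈ Set.Icc (0 : ℝ) 1 := fun i j => by
    induction j using Fin.lastCases with
    | last => simp [hZl]
    | cast k => rw [hZ]; exact hX i k
  have hembed : embed _ (n + 1) X = Matrix.of fun a j =>
      stageState (s := s) N L n 1 0 Z (e.symm a) j := by
    ext a j
    obtain ⟨a, rfl⟩ := e.surjective a
    rw [Matrix.of_apply, Equiv.symm_apply_apply]
    rcases a with i | a
    · induction j using Fin.lastCases with
      | last => simp [embed, stageState, hZl]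
      | cast k => simp [embed, stageState, hZ, e]
    · have h0 : stageState (s := s) N L n 1 0 Z (.inr a) j = 0 := by
        rcases a with ⟨w, b⟩ | w
        · simp only [stageState, Pi.zero_apply]
          split_ifs <;> first | rfl | omega
        · rfl
      rw [h0]
      simp [embed, e]
  obtain ⟨hsupp, hbound, hexp⟩ := hc _ r p hr hp hps (henc r p hr hp hps)
  rw [hembed, hout Z, Matrix.of_apply, Equiv.symm_apply_apply, outputState, hexp X,
    ← Finset.sum_sub_distrib]
  have herr : ∀ w : Word d s,
      |c (enc r p) w * ((∑ k, approxVal N L n Z w k) / n) -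
        c (enc r p) w * wordProd w.1 w.2.1 X| ≤
      |c (enc r p) w| * ((∑ j, ∑ i, p j i : ℕ) * (1 / (N : ℝ) ^ L)) := by
    intro w
    rw [← mul_sub, abs_mul, ← (wordVal_mul w.1 w.2.1 X Z hZ hZl).2.2]
    by_cases hw : w.2.1.length + 1 = ∑ j, ∑ i, p j i
    · gcongr
      refine (wordVal_approx hn (mulApprox_zero_left N L)
        (fun x hx y hy => mulApprox_spec hN L hx hy) hZm hZl w.1 w.2.1).trans ?_
      gcongr
      omega
    · simp [hsupp w hw]
  calc |∑ w, (c (enc r p) w * ((∑ k, approxVal N L n Z w k) / n) -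
          c (enc r p) w * wordProd w.1 w.2.1 X)|
      ≤ ∑ w, |c (enc r p) w| * ((∑ j, ∑ i, p j i : ℕ) * (1 / (N : ℝ) ^ L)) :=
        (Finset.abs_sum_le_sum_abs _ _).trans (Finset.sum_le_sum fun w _ => herr w)
    _ ≤ n.ascFactorial r * ((∑ j, ∑ i, p j i : ℕ) * (1 / (N : ℝ) ^ L)) := by
        rw [← Finset.sum_mul]
        gcongr
    _ = n.ascFactorial r * (∑ j, ∑ i, p j i : ℕ) / (N : ℝ) ^ L := by ring
    _ ≤ _ := by
        gcongr
        exact ascFactorial_mul_sum_le fun j => ∑ i, p j i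
end

section
/- For all d, n ∈ ℕ₊, all r ∈ ℕ₊, and all p_1,…,p_r, p_{r+1} ∈ ℕ^d, the following identity of polynomials in the d·n variables x_{ij} holds: m_{p_1,…,p_r,p_{r+1}}(X) = m_{p_1,…,p_r}(X)·m_{p_{r+1}}(X) − Σ_{j=1}^r m_{p_1,…,p_{j−1}, p_j + p_{r+1}, p_{j+1},…,p_r}(X), where p_j + p_{r+1} denotes coordinatewise addition in ℕ^d. -/
/-- The rank-`r` monomial column-symmetric polynomial
`m_{p_1,…,p_r}(X) = Σ_{σ ∈ S_n} (1/(n−r)!) x_{σ(1)}^{p_1} ⋯ x_{σ(r)}^{p_r}`,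
as a polynomial in the `d·n` variables `x_{ij}`, with the convention that it is
`0` if `r > n`. -/
noncomputable def msymPoly (d n r : ℕ) (p : Fin r → Fin d → ℕ) :
    MvPolynomial (Fin d × Fin n) ℝ :=
  if h : r ≤ n then
    MvPolynomial.C ((((n - r).factorial : ℕ) : ℝ)⁻¹) *
      ∑ σ : Equiv.Perm (Fin n), ∏ j : Fin r, ∏ i : Fin d,
        (MvPolynomial.X (i, σ (Fin.castLE h j))) ^ p j i
  else 0

open Finset in
/-- An injective `r`-tuple in `Fin n` is the initial part of exactly `(n - r)!` permutations. -/
theorem card_perm_extending_s5 {n r : ℕ} (h : r ≤ n) (f : Fin r → Fin n)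
    (hf : Function.Injective f) :
    #{σ : Equiv.Perm (Fin n) | (fun j => σ (Fin.castLE h j)) = f} = (n - r).factorial := by
  classical
  have hsame : ∀ g ∈ ({g | Function.Injective g} : Finset (Fin r → Fin n)),
      #{σ : Equiv.Perm (Fin n) | (fun j => σ (Fin.castLE h j)) = g} =
        #{σ : Equiv.Perm (Fin n) | (fun j => σ (Fin.castLE h j)) = f} := by
    intro g hg
    obtain ⟨τ, hτ⟩ := Equiv.Perm.exists_extending_pair g f (by simpa using hg) hf
    refine card_equiv (Equiv.mulLeft τ) fun σ => ?_
    simp [funext_iff, ← hτ]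
  have htotal := card_eq_sum_card_fiberwise
    (f := fun (σ : Equiv.Perm (Fin n)) (j : Fin r) => σ (Fin.castLE h j))
    (s := univ) (t := {g | Function.Injective g})
    (fun σ _ => mem_coe.2 <| mem_filter.2
      ⟨mem_univ _, σ.injective.comp (Fin.castLE_injective h)⟩)
  have hinj : #({g | Function.Injective g} : Finset (Fin r → Fin n)) = n.descFactorial r := by
    rw [← Fintype.card_subtype,
      Fintype.card_congr (Equiv.subtypeInjectiveEquivEmbedding (Fin r) (Fin n)),
      Fintype.card_embedding_eq, Fintype.card_fin, Fintype.card_fin]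
  rw [sum_congr rfl hsame, sum_const, hinj, card_univ, Fintype.card_perm, Fintype.card_fin,
    ← Nat.factorial_mul_descFactorial h, smul_eq_mul, mul_comm] at htotal
  exact (Nat.eq_of_mul_eq_mul_left (Nat.descFactorial_pos.2 h) htotal).symm

open Classical in
theorem msymPoly_eq_sum_injective (d n r : ℕ) (p : Fin r → Fin d → ℕ) :
    msymPoly d n r p = ∑ f : Fin r → Fin n, if Function.Injective f then
      ∏ j, ∏ i, (MvPolynomial.X (i, f j) : MvPolynomial (Fin d × Fin n) ℝ) ^ p j i else 0 := by
  unfold msymPoly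
  split_ifs with h
  · rw [← Finset.sum_fiberwise Finset.univ
      (fun (σ : Equiv.Perm (Fin n)) (j : Fin r) => σ (Fin.castLE h j)), Finset.mul_sum]
    refine Finset.sum_congr rfl fun f _ => ?_
    split_ifs with hf
    · rw [Finset.sum_congr rfl (g := fun _ => ∏ j, ∏ i,
        (MvPolynomial.X (i, f j) : MvPolynomial (Fin d × Fin n) ℝ) ^ p j i),
        Finset.sum_const, card_perm_extending_s5 h f hf, nsmul_eq_mul, ← mul_assoc,
        ← map_natCast (MvPolynomial.C (R := ℝ)), ← MvPolynomial.C_mul,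
        inv_mul_cancel₀ (by positivity), MvPolynomial.C_1, one_mul]
      intro σ hσ
      simp [← (Finset.mem_filter.1 hσ).2]
    · rw [Finset.filter_false_of_mem, Finset.sum_empty, mul_zero]
      rintro σ - rfl
      exact hf (σ.injective.comp (Fin.castLE_injective h))
  · refine (Finset.sum_eq_zero fun f _ => if_neg fun hf => h ?_).symm
    simpa using Fintype.card_le_of_injective f hf

theorem msymPoly_one (d n : ℕ) (q : Fin d → ℕ) :
    msymPoly d n 1 (fun _ => q) =
      ∑ k : Fin n, ∏ i, (MvPolynomial.X (i, k) : MvPolynomial (Fin d × Fin n) ℝ) ^ q i := by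
  classical
  rw [msymPoly_eq_sum_injective]
  refine Fintype.sum_equiv (Equiv.funUnique (Fin 1) (Fin n)) _ _ fun f => ?_
  simp [Function.injective_of_subsingleton f]

theorem prod_monomial_update {d n r : ℕ} (p : Fin r → Fin d → ℕ) (q : Fin d → ℕ)
    (f : Fin r → Fin n) (j : Fin r) :
    ∏ l, ∏ i, (MvPolynomial.X (i, f l) : MvPolynomial (Fin d × Fin n) ℝ) ^
        Function.update p j (p j + q) l i =
      (∏ l, ∏ i, MvPolynomial.X (i, f l) ^ p l i) * ∏ i, MvPolynomial.X (i, f j) ^ q i := by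
  rw [← Finset.mul_prod_erase _ _ (Finset.mem_univ j),
    ← Finset.mul_prod_erase Finset.univ
      (fun l => ∏ i, (MvPolynomial.X (i, f l) : MvPolynomial (Fin d × Fin n) ℝ) ^ p l i)
      (Finset.mem_univ j), mul_right_comm]
  congr 1
  · simp [pow_add, Finset.prod_mul_distrib]
  · refine Finset.prod_congr rfl fun l hl => ?_
    rw [Function.update_of_ne (Finset.ne_of_mem_erase hl)]

theorem sum_notMem_range {ι α M : Type*} [Fintype ι] [Fintype α] [AddCommGroup M]
    (f : ι → α) (hf : Function.Injective f) [DecidablePred (· ∉ Set.range f)] (g : α → M) :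
    (∑ a, if a ∉ Set.range f then g a else 0) = ∑ a, g a - ∑ j, g (f j) := by
  classical
  rw [eq_sub_iff_add_eq, ← Finset.sum_image (s := Finset.univ) (f := g) hf.injOn,
    ← Finset.sum_filter, ← Finset.sum_filter_not_add_sum_filter Finset.univ (· ∈ Set.range f)]
  congr 2
  ext a
  simp

/-- For `r ≥ 1` and `p_1,…,p_r, p_{r+1} ∈ ℕ^d`:
`m_{p_1,…,p_r,p_{r+1}} = m_{p_1,…,p_r}·m_{p_{r+1}} − Σ_{j=1}^r m_{p_1,…,p_j+p_{r+1},…,p_r}`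
as polynomials in the `d·n` variables `x_{ij}`. -/
theorem stmt5 (d n : ℕ) (hd : 0 < d) (hn : 0 < n) (r : ℕ) (hr : 0 < r)
    (p : Fin r → Fin d → ℕ) (q : Fin d → ℕ) :
    msymPoly d n (r+1) (Fin.snoc p q) =
      msymPoly d n r p * msymPoly d n 1 (fun _ => q) -
        ∑ j : Fin r, msymPoly d n r (Function.update p j (p j + q)) := by
  classical
  rw [msymPoly_one]
  simp only [msymPoly_eq_sum_injective, prod_monomial_update]
  rw [Finset.sum_comm, Finset.sum_mul, ← Finset.sum_sub_distrib,
    ← (Fin.snocEquiv fun _ => Fin n).sum_comp, Fintype.sum_prod_type_right]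
  refine Finset.sum_congr rfl fun f _ => ?_
  simp only [Fin.snocEquiv, Equiv.coe_fn_mk, Fin.snoc_injective_iff, Fin.prod_univ_castSucc,
    Fin.snoc_castSucc, Fin.snoc_last]
  by_cases hf : Function.Injective f
  · simp only [hf, true_and, if_true]
    rw [← Finset.mul_sum, ← mul_sub, ← sum_notMem_range f hf, Finset.mul_sum]
    simp only [mul_ite, mul_zero]
  · simp [hf]
end

section
/- Let s, r, n ∈ ℕ₊ with r ≤ s and r ≤ n, and let p_1,…,p_r ∈ ℕ^d satisfy |p_j| ≥ 1 for every j and |p_1| + ⋯ + |p_r| ≤ s. Then, with P(a,b) := a!/(a−b)!, one has (P(n+r−1, r)/P(n, r)) · (|p_1|+1)(|p_2|+1)⋯(|p_r|+1) < 2^{3s} = 8^s. -/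
theorem descFactorial_shift_lt_four_pow_mul (k m : ℕ) :
    (2 * k + 1 + m).descFactorial (k + 1) <
      4 ^ (k + 1) * (k + 1 + m).descFactorial (k + 1) := by
  induction m with
  | zero =>
    rw [add_zero, add_zero, Nat.descFactorial_eq_factorial_mul_choose, Nat.descFactorial_self,
      Nat.choose_symm_half, mul_comm]
    refine Nat.mul_lt_mul_of_pos_right ?_ (Nat.factorial_pos _)
    exact (Nat.choose_middle_le_pow k).trans_lt (Nat.pow_lt_pow_right (by norm_num) k.lt_succ_self)
  | succ m ih =>
    have hA := Nat.succ_descFactorial (2 * k + 1 + m) (k + 1)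
    have hB := Nat.succ_descFactorial (k + 1 + m) (k + 1)
    rw [show 2 * k + 1 + m + 1 - (k + 1) = k + 1 + m by omega] at hA
    rw [show k + 1 + m + 1 - (k + 1) = m + 1 by omega] at hB
    rw [← add_assoc, ← add_assoc]
    set A := (2 * k + 1 + m).descFactorial (k + 1)
    set B := (k + 1 + m).descFactorial (k + 1)
    set A' := (2 * k + 1 + m + 1).descFactorial (k + 1)
    set B' := (k + 1 + m + 1).descFactorial (k + 1)
    have hpos : 0 < (k + 1 + m) * (m + 1) := by positivity
    refine Nat.lt_of_mul_lt_mul_left (a := (k + 1 + m) * (m + 1)) ?_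
    calc (k + 1 + m) * (m + 1) * A' = (m + 1) * ((k + 1 + m) * A') := by ring
      _ = (m + 1) * (2 * k + 1 + m + 1) * A := by rw [hA]; ring
      _ < (m + 1) * (2 * k + 1 + m + 1) * (4 ^ (k + 1) * B) :=
        Nat.mul_lt_mul_of_pos_left ih (by positivity)
      _ ≤ (k + 1 + m) * (k + 1 + m + 1) * (4 ^ (k + 1) * B) :=
        Nat.mul_le_mul_right _ (by nlinarith)
      _ = (k + 1 + m) * 4 ^ (k + 1) * ((k + 1 + m + 1) * B) := by ring
      _ = (k + 1 + m) * (m + 1) * (4 ^ (k + 1) * B') := by rw [← hB]; ring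

theorem prod_add_one_le_two_pow_sum {ι : Type*} (t : Finset ι) (f : ι → ℕ) :
    ∏ j ∈ t, (f j + 1) ≤ 2 ^ ∑ j ∈ t, f j := by
  rw [← Finset.prod_pow_eq_pow_sum]
  exact Finset.prod_le_prod' fun j _ => Nat.lt_two_pow_self

/-- Let `r ≤ s`, `r ≤ n` (all positive), and `p_1,…,p_r ∈ ℕ^d` with `|p_j| ≥ 1` for all `j`
and `|p_1| + ⋯ + |p_r| ≤ s`. Then `(P(n+r−1,r)/P(n,r))·(|p_1|+1)⋯(|p_r|+1) < 8^s`,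
where `P(a,b) = a!/(a−b)!` is the descending factorial. -/
theorem stmt14 (d s r n : ℕ) (hs : 0 < s) (hr : 0 < r) (hn : 0 < n)
    (hrs : r ≤ s) (hrn : r ≤ n) (p : Fin r → Fin d → ℕ)
    (hp1 : ∀ j, 1 ≤ ∑ i, p j i) (hps : ∑ j, ∑ i, p j i ≤ s) :
    ((n + r - 1).descFactorial r : ℝ) / ((n.descFactorial r : ℕ) : ℝ) *
      ∏ j, (((∑ i, p j i : ℕ) : ℝ) + 1) < 8^s := by
  have hB : (0 : ℝ) < (n.descFactorial r : ℕ) := by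
    exact_mod_cast Nat.descFactorial_pos.2 hrn
  have hratio : ((n + r - 1).descFactorial r : ℝ) / ((n.descFactorial r : ℕ) : ℝ) < 4 ^ s := by
    obtain ⟨k, rfl⟩ : ∃ k, r = k + 1 := ⟨r - 1, by omega⟩
    obtain ⟨m, rfl⟩ := Nat.exists_eq_add_of_le hrn
    have h := descFactorial_shift_lt_four_pow_mul k m
    rw [show 2 * k + 1 + m = k + 1 + m + (k + 1) - 1 by omega] at h
    rw [div_lt_iff₀ hB]
    calc (((k + 1 + m + (k + 1) - 1).descFactorial (k + 1) : ℕ) : ℝ)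
        < 4 ^ (k + 1) * ((k + 1 + m).descFactorial (k + 1) : ℕ) := by exact_mod_cast h
      _ ≤ 4 ^ s * ((k + 1 + m).descFactorial (k + 1) : ℕ) := by
        gcongr
        norm_num
  have hprod : ∏ j, (((∑ i, p j i : ℕ) : ℝ) + 1) ≤ 2 ^ s := by
    exact_mod_cast (prod_add_one_le_two_pow_sum Finset.univ fun j => ∑ i, p j i).trans
      (Nat.pow_le_pow_right two_pos hps)
  calc _ < (4 : ℝ) ^ s * 2 ^ s :=
        mul_lt_mul hratio hprod (Finset.prod_pos fun j _ => by positivity) (by positivity)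
    _ = 8 ^ s := by rw [← mul_pow]; norm_num
end
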